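/- arXiv:1201.2829 — 2 statements merged into one kernel-verified Lean document; each statement's English description precedes it below -/
import Mathlib

section
/- Let A be a weighted pushdown system with integer weights, let ℓ = |Γ|·|Q| and let ε = 1/(ℓ^{(ℓ+1)²} · 2ℓ). Then there exists a stack bounded infinite valid path π with LimInfAvg(π) > −ε if and only if sup{ LimInfAvg(π) : π is a stack bounded infinite valid path } ≥ 0. The same equivalence holds with LimSupAvg in place of LimInfAvg. -/
open scoped BigOperators

namespace PDS

/-- Stack commands over a stack alphabet `Γ`. -/
inductive Com (Γ : Type) where
  | skip : Com Γ
  | pop : Com Γ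
  | push (z : Γ) : Com Γ
  deriving DecidableEq

/-- Action of a stack command on a stack string (top of stack at the head). -/
def Com.apply {Γ : Type} : Com Γ → List Γ → List Γ
  | .skip, α => α
  | .pop, α => α.tail
  | .push z, α => z :: α

/-- A transition (edge) of a pushdown system. -/
structure Edge (Q Γ : Type) where
  q1 : Q
  top : Γ
  q2 : Q
  com : Com Γ
  deriving DecidableEq

/-- A weighted pushdown system. -/
structure WPS (Q Γ : Type) where
  q0 : Q
  bot : Γ
  E : Set (Edge Q Γ)
  w : Edge Q Γ → ℤ
  no_push_bot : ∀ e ∈ E, e.com ≠ Com.push bot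
  no_pop_bot : ∀ e ∈ E, e.top = bot → e.com ≠ Com.pop

variable {Q Γ : Type}

/-- A configuration: stack string (top at head) together with a state. -/
abbrev Config (Q Γ : Type) := List Γ × Q

/-- A genuine configuration has a nonempty stack string. -/
def IsConfig (c : Config Q Γ) : Prop := c.1 ≠ []

/-- The initial configuration `(⊥, q₀)`. -/
def WPS.start (A : WPS Q Γ) : Config Q Γ := ([A.bot], A.q0)

/-- The configuration obtained by taking the edge `e` from `c`. -/
def next (c : Config Q Γ) (e : Edge Q Γ) : Config Q Γ := (e.com.apply c.1, e.q2)

/-- The edge `e` is enabled at configuration `c`. -/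
def WPS.Enabled (A : WPS Q Γ) (c : Config Q Γ) (e : Edge Q Γ) : Prop :=
  e ∈ A.E ∧ c.2 = e.q1 ∧ c.1.head? = some e.top

/-- Validity of a finite path, given by a start configuration and a list of edges. -/
def WPS.Valid (A : WPS Q Γ) : Config Q Γ → List (Edge Q Γ) → Prop
  | _, [] => True
  | c, e :: es => A.Enabled c e ∧ A.Valid (next c e) es

/-- Last configuration of the finite path `(c, es)`. -/
def endc (c : Config Q Γ) (es : List (Edge Q Γ)) : Config Q Γ := es.foldl next c

/-- The list of configurations along the finite path `(c, es)`. -/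
def trace (c : Config Q Γ) (es : List (Edge Q Γ)) : List (Config Q Γ) :=
  List.scanl next c es

/-- Total weight of a finite path. -/
def WPS.wt (A : WPS Q Γ) (es : List (Edge Q Γ)) : ℤ := (es.map A.w).sum

/-- Stack height of a configuration. -/
def height (c : Config Q Γ) : ℕ := c.1.length

/-- Stack height of a finite path: maximal stack height along it. -/
def SH (c : Config Q Γ) (es : List (Edge Q Γ)) : ℕ :=
  ((trace c es).map height).foldr max 0

/-- Additional stack height of a finite path. -/
def ASH (c : Config Q Γ) (es : List (Edge Q Γ)) : ℕ :=
  SH c es - max (height c) (height (endc c es))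

/-- The first configuration of the path is a local minima: its stack string is a
prefix (here: suffix of the list, since the top is at the head) of all stack strings
along the path. -/
def FirstMin (c : Config Q Γ) (es : List (Edge Q Γ)) : Prop :=
  ∀ c' ∈ trace c es, c.1 <:+ c'.1

/-- The edge sequence obtained from `u ++ p₁ ++ v ++ p₂ ++ x` by repeating `p₁` and
`p₂` each `j` times in place. -/
def pumped (u p₁ v p₂ x : List (Edge Q Γ)) (j : ℕ) : List (Edge Q Γ) :=
  u ++ (List.replicate j p₁).flatten ++ v ++ (List.replicate j p₂).flatten ++ x

/-- `(p₁, p₂)` is a pumpable pair of paths for the path `(c, es)`. -/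
def WPS.PumpablePair (A : WPS Q Γ) (c : Config Q Γ) (es p₁ p₂ : List (Edge Q Γ)) : Prop :=
  p₁ ≠ [] ∧ p₂ ≠ [] ∧
    ∃ u v x, es = u ++ p₁ ++ v ++ p₂ ++ x ∧
      ∀ j : ℕ, A.Valid c (pumped u p₁ v p₂ x j)

/-- The path `(c, es)` has a pumpable pair of paths. -/
def WPS.HasPumpablePair (A : WPS Q Γ) (c : Config Q Γ) (es : List (Edge Q Γ)) : Prop :=
  ∃ p₁ p₂, A.PumpablePair c es p₁ p₂

/-- `(c, es)` is a good cycle. -/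
def WPS.GoodCycle (A : WPS Q Γ) (c : Config Q Γ) (es : List (Edge Q Γ)) : Prop :=
  A.Valid c es ∧ 0 < A.wt es ∧ FirstMin c es ∧
    (endc c es).2 = c.2 ∧ (endc c es).1.head? = c.1.head?

/-- `A` has a good cycle reachable from the configuration `c`. -/
def WPS.ReachableGoodCycleFrom (A : WPS Q Γ) (c : Config Q Γ) : Prop :=
  ∃ es₀ es, A.Valid c es₀ ∧ A.GoodCycle (endc c es₀) es

/-- `A` has a good cycle (at some configuration). -/
def WPS.HasGoodCycle (A : WPS Q Γ) : Prop :=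
  ∃ c es, IsConfig c ∧ A.GoodCycle c es

/-- The finite path `(c, es)` contains a good cycle. -/
def ContainsGoodCycle (A : WPS Q Γ) (c : Config Q Γ) (es : List (Edge Q Γ)) : Prop :=
  ∃ es₁ es₂, es = es₁ ++ es₂ ∧ A.GoodCycle (endc c es₁) es₂

/-- Configurations along an infinite path given by an infinite edge sequence. -/
def confs (c : Config Q Γ) (f : ℕ → Edge Q Γ) : ℕ → Config Q Γ
  | 0 => c
  | n + 1 => next (confs c f n) (f n)

/-- Validity of the infinite path `(c, f)`. -/
def WPS.ValidInf (A : WPS Q Γ) (c : Config Q Γ) (f : ℕ → Edge Q Γ) : Prop :=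
  ∀ n, A.Enabled (confs c f n) (f n)

/-- Average weight of the prefix of length `n+1` of an infinite path. -/
noncomputable def avgPref (A : WPS Q Γ) (f : ℕ → Edge Q Γ) (n : ℕ) : ℝ :=
  (∑ i ∈ Finset.range (n + 1), (A.w (f i) : ℝ)) / (n + 1)

/-- Limit-sup of the averages along an infinite path. -/
noncomputable def LimSupAvg (A : WPS Q Γ) (f : ℕ → Edge Q Γ) : ℝ :=
  Filter.limsup (avgPref A f) Filter.atTop

/-- Limit-inf of the averages along an infinite path. -/
noncomputable def LimInfAvg (A : WPS Q Γ) (f : ℕ → Edge Q Γ) : ℝ :=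
  Filter.liminf (avgPref A f) Filter.atTop

/-- An infinite edge sequence is ultimately periodic. -/
def UltPeriodic (f : ℕ → Edge Q Γ) : Prop :=
  ∃ N p : ℕ, 0 < p ∧ ∀ n, N ≤ n → f (n + p) = f n

/-- The infinite path `(c, f)` is stack bounded. -/
def StackBounded (c : Config Q Γ) (f : ℕ → Edge Q Γ) : Prop :=
  ∃ n : ℕ, ∀ k, height (confs c f k) ≤ n

/-- Non-decreasing path: a valid path whose first configuration is a local minima. -/
def WPS.NonDec (A : WPS Q Γ) (c : Config Q Γ) (es : List (Edge Q Γ)) : Prop :=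
  A.Valid c es ∧ FirstMin c es

/-- Summary function, valued in `EReal`: `⊥` means there is no non-decreasing path
from `(⊥γ,q₁)` to `(⊥γ,q₂)`, `⊤` means `ω` (weights unbounded from above), and
otherwise the value is the maximal weight of such a path. -/
noncomputable def WPS.summary (A : WPS Q Γ) (q₁ : Q) (γ : Γ) (q₂ : Q) : EReal :=
  sSup { x : EReal | ∃ es, A.NonDec ([γ, A.bot], q₁) es ∧
    endc ([γ, A.bot], q₁) es = ([γ, A.bot], q₂) ∧ x = ((A.wt es : ℝ) : EReal) }

/-- Stack height bounded summary function: as `summary` but only over non-decreasing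
paths of additional stack height at most `d`. -/
noncomputable def WPS.summaryBdd (A : WPS Q Γ) (d : ℕ) (q₁ : Q) (γ : Γ) (q₂ : Q) : EReal :=
  sSup { x : EReal | ∃ es, A.NonDec ([γ, A.bot], q₁) es ∧
    endc ([γ, A.bot], q₁) es = ([γ, A.bot], q₂) ∧ ASH ([γ, A.bot], q₁) es ≤ d ∧
    x = ((A.wt es : ℝ) : EReal) }

/-- Edges of the summary graph `Gr(A)` together with their weights in `EReal`
(`⊤` plays the role of `ω`): skip edges weighted by the summary function and push
edges weighted by the corresponding transition weight. -/
def WPS.GrEdge (A : WPS Q Γ) (v₁ v₂ : Q × Γ) (x : EReal) : Prop :=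
  (v₁.2 = v₂.2 ∧ A.summary v₁.1 v₁.2 v₂.1 ≠ ⊥ ∧ x = A.summary v₁.1 v₁.2 v₂.1) ∨
  (∃ e ∈ A.E, e.q1 = v₁.1 ∧ e.top = v₁.2 ∧ e.q2 = v₂.1 ∧ e.com = Com.push v₂.2 ∧
    x = ((A.w e : ℝ) : EReal))

/-- The summary graph `Gr(A)` has a positive simple cycle: a simple cycle containing
an `ω`-edge or whose total weight is positive. -/
def WPS.PosSimpleCycle (A : WPS Q Γ) : Prop :=
  ∃ (k : ℕ) (v : Fin (k + 1) → Q × Γ) (x : Fin (k + 1) → EReal),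
    Function.Injective v ∧ (∀ i, A.GrEdge (v i) (v (i + 1)) (x i)) ∧
    ((∃ i, x i = ⊤) ∨ (0 : EReal) < ∑ i, x i)

/-- Weight of a finite path under the shifted weight function `w + r`. -/
def WPS.wtQ (A : WPS Q Γ) (r : ℚ) (es : List (Edge Q Γ)) : ℚ :=
  (es.map (fun e => (A.w e : ℚ) + r)).sum

/-- The shifted system `A^r` (weight function `w + r`) has a good cycle. -/
def WPS.GoodCycleShift (A : WPS Q Γ) (r : ℚ) : Prop :=
  ∃ c es, IsConfig c ∧ A.Valid c es ∧ 0 < A.wtQ r es ∧ FirstMin c es ∧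
    (endc c es).2 = c.2 ∧ (endc c es).1.head? = c.1.head?

end PDS

namespace PDS

variable {Q Γ : Type}

/-- `Deriv A S (γ, q, q') n w`: there is a run of length `n` and weight `w` from state `q` to
state `q'` which starts and ends with the same stack, has `γ` on top of it, and never goes below
it. A run decomposes as a binary tree; `S` constrains the labels of the proper subtrees. -/
inductive Deriv (A : WPS Q Γ) (S : Set (Γ × Q × Q)) : Γ × Q × Q → ℕ → ℤ → Prop
  | nil (γ : Γ) (q : Q) : Deriv A S (γ, q, q) 0 0
  | skip {γ : Γ} {q r q' : Q} {n : ℕ} {w : ℤ} : ⟨q, γ, r, .skip⟩ ∈ A.E →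
      (γ, r, q') ∈ S → Deriv A S (γ, r, q') n w →
      Deriv A S (γ, q, q') (n + 1) (A.w ⟨q, γ, r, .skip⟩ + w)
  | push {γ z : Γ} {q r r' s q' : Q} {n m : ℕ} {v w : ℤ} : ⟨q, γ, r, .push z⟩ ∈ A.E →
      ⟨r', z, s, .pop⟩ ∈ A.E → (z, r, r') ∈ S → (γ, s, q') ∈ S →
      Deriv A S (z, r, r') n v → Deriv A S (γ, s, q') m w →
      Deriv A S (γ, q, q') (n + m + 2)
        (A.w ⟨q, γ, r, .push z⟩ + A.w ⟨r', z, s, .pop⟩ + (v + w))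

/-- Derivations of `K'` can be completed to derivations of `K` by adding `a` edges of total
weight `b`. -/
def Ctx (A : WPS Q Γ) (K K' : Γ × Q × Q) (a : ℕ) (b : ℤ) : Prop :=
  ∀ m v, Deriv A Set.univ K' m v → Deriv A Set.univ K (a + m) (b + v)

theorem Deriv.mono {A : WPS Q Γ} {S S' : Set (Γ × Q × Q)} (hS : S ⊆ S') {K : Γ × Q × Q} {n : ℕ}
    {w : ℤ} (h : Deriv A S K n w) : Deriv A S' K n w := by
  induction h with
  | nil γ q => exact .nil γ q
  | skip he h1 _ ih => exact .skip he (hS h1) ih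
  | push he he' h1 h2 _ _ ih1 ih2 => exact .push he he' (hS h1) (hS h2) ih1 ih2

theorem Deriv.univ {A : WPS Q Γ} {S : Set (Γ × Q × Q)} {K : Γ × Q × Q} {n : ℕ} {w : ℤ}
    (h : Deriv A S K n w) : Deriv A Set.univ K n w :=
  h.mono (Set.subset_univ S)

theorem Deriv.weight_eq_zero {A : WPS Q Γ} {S : Set (Γ × Q × Q)} {K : Γ × Q × Q} {w : ℤ}
    (h : Deriv A S K 0 w) : w = 0 := by
  cases h
  rfl

theorem Ctx.refl (A : WPS Q Γ) (K : Γ × Q × Q) : Ctx A K K 0 0 := fun m v h => by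
  simpa using h

theorem Ctx.comp {A : WPS Q Γ} {K K' K'' : Γ × Q × Q} {a a' : ℕ} {b b' : ℤ}
    (h : Ctx A K K' a b) (h' : Ctx A K' K'' a' b') : Ctx A K K'' (a + a') (b + b') :=
  fun m v hm => by
    have := h _ _ (h' _ _ hm)
    rwa [← add_assoc, ← add_assoc] at this

theorem Ctx.iterate {A : WPS Q Γ} {K : Γ × Q × Q} {a : ℕ} {b : ℤ} (h : Ctx A K K a b) (j : ℕ) :
    Ctx A K K (j * a) (j * b) := by
  induction j with
  | zero => simpa using Ctx.refl A K
  | succ j ih =>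
    have := ih.comp h
    convert this using 1 <;> push_cast <;> ring

theorem Ctx.of_skip {A : WPS Q Γ} {γ : Γ} {q r q' : Q} (he : ⟨q, γ, r, .skip⟩ ∈ A.E) :
    Ctx A (γ, q, q') (γ, r, q') 1 (A.w ⟨q, γ, r, .skip⟩) := fun m v h => by
  rw [add_comm 1 m]
  exact .skip he trivial h

theorem Ctx.of_push_left {A : WPS Q Γ} {γ z : Γ} {q r r' s q' : Q} {m : ℕ} {w : ℤ}
    (he : ⟨q, γ, r, .push z⟩ ∈ A.E) (he' : ⟨r', z, s, .pop⟩ ∈ A.E)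
    (h : Deriv A Set.univ (γ, s, q') m w) :
    Ctx A (γ, q, q') (z, r, r') (m + 2)
      (A.w ⟨q, γ, r, .push z⟩ + A.w ⟨r', z, s, .pop⟩ + w) := fun n v h' => by
  have := Deriv.push (S := Set.univ) he he' trivial trivial h' h
  convert this using 1 <;> ring

theorem Ctx.of_push_right {A : WPS Q Γ} {γ z : Γ} {q r r' s q' : Q} {n : ℕ} {v : ℤ}
    (he : ⟨q, γ, r, .push z⟩ ∈ A.E) (he' : ⟨r', z, s, .pop⟩ ∈ A.E)
    (h : Deriv A Set.univ (z, r, r') n v) :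
    Ctx A (γ, q, q') (γ, s, q') (n + 2)
      (A.w ⟨q, γ, r, .push z⟩ + A.w ⟨r', z, s, .pop⟩ + v) := fun m w h' => by
  have := Deriv.push (S := Set.univ) he he' trivial trivial h h'
  convert this using 1 <;> ring

/-- Either `K'` labels no proper subtree of a derivation, or the derivation splits at a minimal
subtree labelled `K'`. -/
theorem Deriv.split {A : WPS Q Γ} {S : Set (Γ × Q × Q)} {K : Γ × Q × Q} {n : ℕ} {w : ℤ}
    (h : Deriv A S K n w) (K' : Γ × Q × Q) :
    Deriv A (S \ {K'}) K n w ∨ ∃ a b m v, n = a + m ∧ w = b + v ∧ Ctx A K K' a b ∧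
      Deriv A (S \ {K'}) K' m v := by
  have lift {K K₁ : Γ × Q × Q} {a n₁ : ℕ} {b w₁ : ℤ} (hc : Ctx A K K₁ a b)
      (ih : Deriv A (S \ {K'}) K₁ n₁ w₁ ∨ ∃ a b m v, n₁ = a + m ∧ w₁ = b + v ∧
        Ctx A K₁ K' a b ∧ Deriv A (S \ {K'}) K' m v) :
      (Deriv A (S \ {K'}) K₁ n₁ w₁ ∧ K₁ ≠ K') ∨ ∃ a' b' m v, a + n₁ = a' + m ∧ b + w₁ = b' + v ∧
        Ctx A K K' a' b' ∧ Deriv A (S \ {K'}) K' m v := by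
    rcases ih with ih | ⟨a', b', m, v, rfl, rfl, hc', hd⟩
    · by_cases hK : K₁ = K'
      · subst hK
        exact .inr ⟨a, b, n₁, w₁, rfl, rfl, hc, ih⟩
      · exact .inl ⟨ih, hK⟩
    · exact .inr ⟨a + a', b + b', m, v, by ring, by ring, hc.comp hc', hd⟩
  induction h with
  | nil γ q => exact .inl (.nil γ q)
  | skip he h1 hd ih =>
    rcases lift (Ctx.of_skip he) ih with ⟨hd', hne⟩ | ⟨a, b, m, v, e1, e2, hc, hm⟩
    · exact .inl (.skip he ⟨h1, hne⟩ hd')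
    · exact .inr ⟨a, b, m, v, by omega, e2, hc, hm⟩
  | push he he' h1 h2 hd1 hd2 ih1 ih2 =>
    rcases lift (Ctx.of_push_left he he' hd2.univ) ih1 with
      ⟨hd1', hne1⟩ | ⟨a, b, m, v, e1, e2, hc, hm⟩
    · rcases lift (Ctx.of_push_right he he' hd1.univ) ih2 with
        ⟨hd2', hne2⟩ | ⟨a, b, m, v, e1, e2, hc, hm⟩
      · exact .inl (.push he he' ⟨h1, hne1⟩ ⟨h2, hne2⟩ hd1' hd2')
      · exact .inr ⟨a, b, m, v, by omega, by linarith, hc, hm⟩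
    · exact .inr ⟨a, b, m, v, by omega, by linarith, hc, hm⟩

/-- If pumping is always losing, short derivations shrink to ones of length less than `2 ^ k`. -/
theorem Deriv.exists_shrink_of_le {A : WPS Q Γ} [Finite Q] [Finite Γ] {K₀ : Γ × Q × Q} {B : ℕ}
    (hneg : ∀ K a b n w m v, Ctx A K₀ K a b → Ctx A K K n w → Deriv A Set.univ K m v →
      n = 0 ∧ w = 0 ∨ w < 0) (k : ℕ) : ∀ {S : Set (Γ × Q × Q)} {K : Γ × Q × Q} {n : ℕ} {w : ℤ}
      {a : ℕ} {b : ℤ},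
      S.ncard ≤ k → K ∈ S → Ctx A K₀ K a b → Deriv A S K n w → n ≤ B →
      ∃ n' w', Deriv A Set.univ K n' w' ∧ n' + 2 ≤ 2 ^ k ∧
        (B : ℤ) * w + n ≤ B * w' + n' := by
  induction k with
  | zero =>
    intro S K n w a b hS hK
    rw [Nat.le_zero, Set.ncard_eq_zero] at hS
    simp [hS] at hK
  | succ k IH =>
    intro S K n w a b hS hK hc hd hn
    obtain ⟨m, v, hm, hmB, hmv⟩ : ∃ m v, Deriv A (S \ {K}) K m v ∧ m ≤ B ∧
        (B : ℤ) * w + n ≤ B * v + m := by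
      rcases hd.split K with h | ⟨a', b', m, v, rfl, rfl, hc', hm⟩
      · exact ⟨n, w, h, hn, le_rfl⟩
      · refine ⟨m, v, hm, by omega, ?_⟩
        rcases hneg K a b a' b' m v hc hc' hm.univ with ⟨rfl, rfl⟩ | hb
        · simp
        · have : (a' : ℤ) ≤ B := by exact_mod_cast (by omega : a' ≤ B)
          push_cast
          nlinarith
    have hS' : (S \ {K}).ncard ≤ k := by
      rw [Set.ncard_sdiff_singleton_of_mem hK]
      omega
    suffices ∃ n' w', Deriv A Set.univ K n' w' ∧ n' + 2 ≤ 2 ^ (k + 1) ∧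
        (B : ℤ) * v + m ≤ B * w' + n' by
      obtain ⟨n', w', h1, h2, h3⟩ := this
      exact ⟨n', w', h1, h2, hmv.trans h3⟩
    rw [pow_succ]
    have hk : 0 < 2 ^ k := by positivity
    cases hm with
    | nil γ q => exact ⟨0, 0, .nil γ q, by omega, le_rfl⟩
    | skip he h1 hd1 =>
      obtain ⟨n', w', h1, h2, h3⟩ := IH hS' h1 (hc.comp (Ctx.of_skip he)) hd1 (by omega)
      exact ⟨_, _, .skip he trivial h1, by omega, by push_cast; linarith⟩
    | push he he' h1 h2 hd1 hd2 =>
      obtain ⟨n₁, w₁, k1, k2, k3⟩ := IH hS' h1 (hc.comp (Ctx.of_push_left he he' hd2.univ)) hd1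
        (by omega)
      obtain ⟨n₂, w₂, l1, l2, l3⟩ := IH hS' h2 (hc.comp (Ctx.of_push_right he he' hd1.univ)) hd2
        (by omega)
      exact ⟨_, _, .push he he' trivial trivial k1 l1, by omega, by push_cast; linarith⟩

theorem Deriv.exists_shrink {A : WPS Q Γ} [Finite Q] [Finite Γ] {K₀ : Γ × Q × Q} {B : ℕ}
    (hneg : ∀ K a b n w m v, Ctx A K₀ K a b → Ctx A K K n w → Deriv A Set.univ K m v →
      n = 0 ∧ w = 0 ∨ w < 0) (hB : B + 2 = 2 ^ (Nat.card (Γ × Q × Q) + 1)) {K : Γ × Q × Q} {n : ℕ}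
    {w : ℤ} (h : Deriv A Set.univ K n w) : ∀ {a : ℕ} {b : ℤ}, Ctx A K₀ K a b →
      ∃ n' w', Deriv A Set.univ K n' w' ∧ n' + 2 ≤ 2 ^ Nat.card (Γ × Q × Q) ∧
        (B : ℤ) * w + n ≤ B * w' + n' := by
  rw [pow_succ] at hB
  have shrink {K : Γ × Q × Q} {n m : ℕ} {w v : ℤ} {a : ℕ} {b : ℤ} (hc : Ctx A K₀ K a b)
      (hd : Deriv A Set.univ K n w) (hn : n ≤ B) (hle : (B : ℤ) * v + m ≤ B * w + n) :
      ∃ n' w', Deriv A Set.univ K n' w' ∧ n' + 2 ≤ 2 ^ Nat.card (Γ × Q × Q) ∧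
        (B : ℤ) * v + m ≤ B * w' + n' := by
    obtain ⟨n', w', h1, h2, h3⟩ := Deriv.exists_shrink_of_le hneg _
      (Set.ncard_univ _).le (Set.mem_univ K) hc hd hn
    exact ⟨n', w', h1, h2, hle.trans h3⟩
  induction h with
  | nil γ q => exact fun hc => shrink hc (.nil γ q) (by omega) le_rfl
  | skip he h1 hd ih =>
    intro a b hc
    obtain ⟨n', w', h1, h2, h3⟩ := ih (hc.comp (Ctx.of_skip he))
    exact shrink hc (.skip he trivial h1) (by omega) (by push_cast; linarith)
  | push he he' h1 h2 hd1 hd2 ih1 ih2 =>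
    intro a b hc
    obtain ⟨n₁, w₁, k1, k2, k3⟩ := ih1 (hc.comp (Ctx.of_push_left he he' hd2))
    obtain ⟨n₂, w₂, l1, l2, l3⟩ := ih2 (hc.comp (Ctx.of_push_right he he' hd1))
    exact shrink hc (.push he he' trivial trivial k1 l1) (by omega) (by push_cast; linarith)

/-- If all cycles have average weight less than `-δ`, then pumping is always losing. -/
theorem pump_neg {A : WPS Q Γ} {K₀ : Γ × Q × Q} {δ : ℝ} (hδ : 0 < δ)
    (h : ∀ n w, Deriv A Set.univ K₀ n w → (w : ℝ) ≤ -δ * n) (K : Γ × Q × Q) (a : ℕ) (b : ℤ)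
    (n : ℕ) (w : ℤ) (m : ℕ) (v : ℤ) (hc : Ctx A K₀ K a b) (hp : Ctx A K K n w)
    (hd : Deriv A Set.univ K m v) : n = 0 ∧ w = 0 ∨ w < 0 := by
  by_contra! hcon
  obtain ⟨h1, hw⟩ := hcon
  have hpos : 0 < (w : ℝ) + δ * n := by
    rcases Nat.eq_zero_or_pos n with rfl | hn
    · have : 0 < w := lt_of_le_of_ne hw (Ne.symm (h1 rfl))
      simpa using this
    · have : (0 : ℝ) ≤ w := by exact_mod_cast hw
      positivity
  obtain ⟨j, hj⟩ := exists_nat_gt ((-δ * (a + m) - (b + v)) / ((w : ℝ) + δ * n))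
  rw [div_lt_iff₀ hpos] at hj
  have := h _ _ (hc _ _ (hp.iterate j _ _ hd))
  push_cast at this
  nlinarith

theorem exists_cycle_avg_ge {A : WPS Q Γ} [Finite Q] [Finite Γ] {γ : Γ} {q : Q} {n B : ℕ} {w : ℤ}
    (hB : B + 2 = 2 ^ (Nat.card (Γ × Q × Q) + 1))
    (h : Deriv A Set.univ (γ, q, q) n w) (hw : 0 < (B : ℤ) * w + n) {δ : ℝ} (hδ : 0 < δ) :
    ∃ n w, 0 < n ∧ Deriv A Set.univ (γ, q, q) n w ∧ -δ * n ≤ w := by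
  by_contra! hcon
  have hcon' : ∀ n w, Deriv A Set.univ (γ, q, q) n w → (w : ℝ) ≤ -δ * n := by
    intro n w hd
    rcases Nat.eq_zero_or_pos n with rfl | hn
    · simp [hd.weight_eq_zero]
    · exact (hcon n w hn hd).le
  obtain ⟨n', w', h1, h2, h3⟩ := h.exists_shrink (pump_neg hδ hcon') hB (Ctx.refl A _)
  rcases Nat.eq_zero_or_pos n' with rfl | hn'
  · have := h1.weight_eq_zero
    subst this
    simp at h3
    omega
  · have hneg : (w' : ℝ) < 0 := (hcon n' w' hn' h1).trans_le (by
      have : (0 : ℝ) < n' := by exact_mod_cast hn'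
      nlinarith)
    have hneg' : w' < 0 := by exact_mod_cast hneg
    have : (n' : ℤ) ≤ B := by
      rw [pow_succ] at hB
      exact_mod_cast (by omega : n' ≤ B)
    nlinarith

/-- `Chain A β q q' n w`: a run of length `n` and weight `w` which starts in state `q` with `β` on
top of a stack and pops `β` down to its bottom symbol. -/
inductive Chain (A : WPS Q Γ) : List Γ → Q → Q → ℕ → ℤ → Prop
  | single {γ : Γ} {q q' : Q} {n : ℕ} {w : ℤ} : Deriv A Set.univ (γ, q, q') n w →
      Chain A [γ] q q' n w
  | cons {z : Γ} {β : List Γ} {q r s q' : Q} {n m : ℕ} {v w : ℤ} :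
      Deriv A Set.univ (z, q, r) n v → ⟨r, z, s, .pop⟩ ∈ A.E → Chain A β s q' m w →
      Chain A (z :: β) q q' (n + m + 1) (A.w ⟨r, z, s, .pop⟩ + (v + w))

theorem Chain.deriv {A : WPS Q Γ} {γ : Γ} {q q' : Q} {n : ℕ} {w : ℤ} (h : Chain A [γ] q q' n w) :
    Deriv A Set.univ (γ, q, q') n w := by
  generalize hβ : [γ] = β at h
  cases h with
  | single hd =>
    cases hβ
    exact hd
  | cons _ _ hc =>
    cases hβ
    cases hc

/-- Prepending one transition to a chain. -/
theorem Chain.step {A : WPS Q Γ} {e : Edge Q Γ} (he : e ∈ A.E) {β' : List Γ} {q' : Q} {n : ℕ}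
    {w : ℤ} (h : Chain A (e.com.apply (e.top :: β')) e.q2 q' n w) :
    Chain A (e.top :: β') e.q1 q' (n + 1) (A.w e + w) := by
  obtain ⟨q, γ, r, com⟩ := e
  cases com with
  | skip =>
    cases h with
    | single hd => exact .single (.skip he trivial hd)
    | @cons _ _ _ r' s _ n m v w hd he' hc =>
      have := Chain.cons (.skip he trivial hd) he' hc
      convert this using 1 <;> ring
  | pop =>
    have h' : Chain A β' r q' n w := h
    have := Chain.cons (.nil γ q) he h'
    convert this using 1
    all_goals ring
  | push y =>
    cases h with
    | @cons _ _ _ r' s _ n m v w hd he' hc =>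
      cases hc with
      | single hd' =>
        have := Deriv.push (S := Set.univ) he he' trivial trivial hd hd'
        convert Chain.single this using 1
        ring
      | @cons _ _ _ r₁ s₁ _ n₁ m₁ v₁ w₁ hd' he'' hc' =>
        have := Chain.cons (Deriv.push he he' trivial trivial hd hd') he'' hc'
        convert this using 1 <;> ring

/-- A segment of a path which stays strictly above `α` prolongs a chain. -/
theorem Chain.of_segment {A : WPS Q Γ} {c : Config Q Γ} {f : ℕ → Edge Q Γ} (hv : A.ValidInf c f)
    {α β' : List Γ} {q' : Q} {n : ℕ} {w : ℤ} (k : ℕ) : ∀ {i : ℕ} {β : List Γ},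
    (confs c f i).1 = β ++ α → (∀ j ≤ k, α.length < height (confs c f (i + j))) →
    (confs c f (i + k)).1 = β' ++ α → Chain A β' (confs c f (i + k)).2 q' n w →
    Chain A β (confs c f i).2 q' (k + n) (∑ j ∈ Finset.range k, A.w (f (i + j)) + w) := by
  induction k with
  | zero =>
    intro i β h1 _ h2 h
    have : β = β' := List.append_cancel_right (h1.symm.trans h2)
    subst this
    simpa using h
  | succ k ih =>
    intro i β h1 hh h2 h
    obtain ⟨he, hq, ht⟩ := hv i
    cases β with
    | nil =>
      have := hh 0 (by omega)
      simp [height, h1] at this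
    | cons z β =>
      rw [h1] at ht
      have hz : z = (f i).top := by simpa using ht
      subst hz
      rw [hq, Finset.sum_range_succ']
      have hnext : (confs c f (i + 1)).1 = (f i).com.apply ((f i).top :: β) ++ α := by
        simp only [confs, next, h1]
        cases (f i).com <;> simp [Com.apply]
      have h' := ih hnext (fun j hj => by
        have := hh (j + 1) (by omega)
        rwa [add_right_comm, add_assoc]) (by rwa [add_right_comm, add_assoc])
        (by rwa [add_right_comm, add_assoc])
      convert Chain.step he h' using 1
      · omega
      · simp only [add_zero, add_assoc, add_comm 1]
        ring

theorem exists_confs_eq_append {c : Config Q Γ} {f : ℕ → Edge Q Γ} {α : List Γ}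
    {i : ℕ} (h : ∃ β, (confs c f i).1 = β ++ α) (k : ℕ)
    (hk : ∀ j ≤ k, α.length < height (confs c f (i + j))) :
    ∃ β, (confs c f (i + k)).1 = β ++ α := by
  induction k with
  | zero => exact h
  | succ k ih =>
    obtain ⟨β, hβ⟩ := ih fun j hj => hk j (by omega)
    have hlen := hk k (by omega)
    rw [← add_assoc]
    cases β with
    | nil => simp [height, hβ] at hlen
    | cons z β =>
      simp only [confs, next, hβ]
      cases (f (i + k)).com with
      | skip => exact ⟨z :: β, rfl⟩
      | pop => exact ⟨β, rfl⟩
      | push y => exact ⟨y :: z :: β, rfl⟩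

/-- A cycle of configurations, rotated to a configuration of minimal height. -/
theorem exists_deriv_of_confs_eq {A : WPS Q Γ} {c : Config Q Γ} {f : ℕ → Edge Q Γ}
    (hv : A.ValidInf c f) {i p : ℕ} (h : confs c f i = confs c f (i + p)) :
    ∃ γ q, Deriv A Set.univ (γ, q, q) p (∑ j ∈ Finset.range p, A.w (f (i + j))) := by
  obtain ⟨m, hm, hmin⟩ := (Finset.range (p + 1)).exists_min_image
    (fun j => height (confs c f (i + j))) ⟨0, by simp⟩
  simp only [Finset.mem_range, Nat.lt_succ_iff] at hm hmin
  obtain ⟨k, rfl⟩ := Nat.exists_eq_add_of_le hm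
  obtain ⟨γ, α, hα⟩ : ∃ γ α, (confs c f (i + m)).1 = [γ] ++ α := by
    obtain ⟨_, _, ht⟩ := hv (i + m)
    cases hs : (confs c f (i + m)).1 with
    | nil => simp [hs] at ht
    | cons z α => exact ⟨z, α, rfl⟩
  have hgt : ∀ j ≤ m + k, α.length < height (confs c f (i + j)) := fun j hj =>
    lt_of_lt_of_le (by simp [height, hα]) (hmin j hj)
  have hgt' : ∀ j ≤ k, α.length < height (confs c f (i + m + j)) := fun j hj => by
    rw [add_assoc]
    exact hgt _ (by omega)
  obtain ⟨β, hβ⟩ := exists_confs_eq_append ⟨_, hα⟩ k hgt'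
  rw [← add_assoc] at h
  have h1 := Chain.of_segment hv m (h ▸ hβ) (fun j hj => hgt j (by omega)) hα
    (.single (.nil γ (confs c f (i + m)).2))
  rw [h] at h1
  have h2 := Chain.of_segment hv k hα hgt' hβ h1
  refine ⟨γ, (confs c f (i + m)).2, ?_⟩
  rw [Finset.sum_range_add]
  convert h2.deriv using 1
  · omega
  · simp only [add_assoc]
    ring

instance [Finite Γ] : Finite (Com Γ) := by
  refine Finite.of_surjective (fun x : Option (Option Γ) => match x with
    | none => Com.skip
    | some none => Com.pop
    | some (some z) => Com.push z) ?_
  rintro (_ | _ | z)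
  exacts [⟨none, rfl⟩, ⟨some none, rfl⟩, ⟨some (some z), rfl⟩]

instance [Finite Q] [Finite Γ] : Finite (Edge Q Γ) :=
  Finite.of_surjective (fun x : Q × Γ × Q × Com Γ => Edge.mk x.1 x.2.1 x.2.2.1 x.2.2.2)
    fun e => ⟨(e.q1, e.top, e.q2, e.com), rfl⟩

theorem exists_abs_avgPref_le [Finite Q] [Finite Γ] (A : WPS Q Γ) (f : ℕ → Edge Q Γ) :
    ∃ M, ∀ n, |avgPref A f n| ≤ M := by
  obtain ⟨M, hM⟩ := (Set.finite_range fun e : Edge Q Γ => |(A.w e : ℝ)|).bddAbove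
  refine ⟨M, fun n => ?_⟩
  rw [avgPref, abs_div, abs_of_pos (by positivity : (0 : ℝ) < n + 1),
    div_le_iff₀ (by positivity : (0 : ℝ) < n + 1)]
  refine (Finset.abs_sum_le_sum_abs _ _).trans
    ((Finset.sum_le_card_nsmul _ _ M fun i _ => hM ⟨f i, rfl⟩).trans_eq ?_)
  simp
  ring

theorem isBoundedUnder_le_avgPref [Finite Q] [Finite Γ] (A : WPS Q Γ) (f : ℕ → Edge Q Γ) :
    Filter.IsBoundedUnder (· ≤ ·) Filter.atTop (avgPref A f) := by
  obtain ⟨M, hM⟩ := exists_abs_avgPref_le A f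
  exact Filter.isBoundedUnder_of ⟨M, fun n => (abs_le.1 (hM n)).2⟩

theorem isBoundedUnder_ge_avgPref [Finite Q] [Finite Γ] (A : WPS Q Γ) (f : ℕ → Edge Q Γ) :
    Filter.IsBoundedUnder (· ≥ ·) Filter.atTop (avgPref A f) := by
  obtain ⟨M, hM⟩ := exists_abs_avgPref_le A f
  exact Filter.isBoundedUnder_of ⟨-M, fun n => (abs_le.1 (hM n)).1⟩

theorem limInfAvg_le_limSupAvg [Finite Q] [Finite Γ] (A : WPS Q Γ) (f : ℕ → Edge Q Γ) :
    LimInfAvg A f ≤ LimSupAvg A f :=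
  Filter.liminf_le_limsup (isBoundedUnder_le_avgPref A f) (isBoundedUnder_ge_avgPref A f)

theorem tendsto_const_add_div_add_one (a D : ℝ) :
    Filter.Tendsto (fun n : ℕ => a + D / ((n : ℝ) + 1)) Filter.atTop (nhds a) := by
  have : Filter.Tendsto (fun n : ℕ => D / ((n : ℝ) + 1)) Filter.atTop (nhds 0) :=
    tendsto_const_nhds.div_atTop
      (Filter.tendsto_atTop_add_const_right _ _ tendsto_natCast_atTop_atTop)
  simpa using this.const_add a

theorem limSupAvg_le [Finite Q] [Finite Γ] {A : WPS Q Γ} {f : ℕ → Edge Q Γ} {a D : ℝ}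
    (h : ∀ n : ℕ, ∑ i ∈ Finset.range n, (A.w (f i) : ℝ) ≤ a * n + D) : LimSupAvg A f ≤ a := by
  have ht := tendsto_const_add_div_add_one a D
  rw [← ht.limsup_eq]
  refine Filter.limsup_le_limsup (.of_forall fun n => ?_)
    (isBoundedUnder_ge_avgPref A f).isCoboundedUnder_le ht.isBoundedUnder_le
  have hn : (0 : ℝ) < n + 1 := by positivity
  rw [avgPref, div_le_iff₀ hn, add_mul, div_mul_cancel₀ _ hn.ne']
  exact_mod_cast h (n + 1)

theorem le_limInfAvg [Finite Q] [Finite Γ] {A : WPS Q Γ} {f : ℕ → Edge Q Γ} {a D : ℝ}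
    (h : ∀ n : ℕ, a * n + D ≤ ∑ i ∈ Finset.range n, (A.w (f i) : ℝ)) : a ≤ LimInfAvg A f := by
  have ht := tendsto_const_add_div_add_one a D
  rw [← ht.liminf_eq]
  refine Filter.liminf_le_liminf (.of_forall fun n => ?_) ht.isBoundedUnder_ge
    (isBoundedUnder_le_avgPref A f).isCoboundedUnder_ge
  have hn : (0 : ℝ) < n + 1 := by positivity
  rw [avgPref, le_div_iff₀ hn, add_mul, div_mul_cancel₀ _ hn.ne']
  exact_mod_cast h (n + 1)

theorem StackBounded.finite_range [Finite Q] [Finite Γ] {c : Config Q Γ} {f : ℕ → Edge Q Γ}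
    (h : StackBounded c f) : (Set.range (confs c f)).Finite := by
  obtain ⟨n, hn⟩ := h
  refine ((List.finite_length_le Γ n).prod (Set.finite_univ (α := Q))).subset ?_
  rintro _ ⟨k, rfl⟩
  exact ⟨hn k, trivial⟩

/-- A stack bounded path with limsup-average above `a` has a cycle with average above `a`. -/
theorem exists_cycle_of_lt_limSupAvg [Finite Q] [Finite Γ] {A : WPS Q Γ} {c : Config Q Γ}
    {f : ℕ → Edge Q Γ} (hv : A.ValidInf c f) (hb : StackBounded c f) {a : ℝ}
    (h : a < LimSupAvg A f) :
    ∃ γ q n w, Deriv A Set.univ (γ, q, q) n w ∧ a * n < w := by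
  by_contra! hcon
  refine h.not_ge ?_
  have hx : ∀ x, ∃ C : ℝ, ∀ n : ℕ, confs c f n = x →
      ∑ i ∈ Finset.range n, (A.w (f i) : ℝ) - a * n ≤ C := by
    classical
    intro x
    by_cases hex : ∃ n, confs c f n = x
    · refine ⟨∑ i ∈ Finset.range (Nat.find hex), (A.w (f i) : ℝ) - a * Nat.find hex,
        fun n hn => ?_⟩
      obtain ⟨p, rfl⟩ := Nat.exists_eq_add_of_le (Nat.find_min' hex hn)
      obtain ⟨γ, q, hd⟩ := exists_deriv_of_confs_eq hv ((Nat.find_spec hex).trans hn.symm)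
      have := hcon _ _ _ _ hd
      rw [Finset.sum_range_add]
      push_cast at this ⊢
      linarith
    · exact ⟨0, fun n hn => absurd ⟨n, hn⟩ hex⟩
  choose C hC using hx
  obtain ⟨D, hD⟩ := (hb.finite_range.image C).bddAbove
  refine limSupAvg_le (D := D) fun n => ?_
  have h1 := hC _ n rfl
  have h2 : C (confs c f n) ≤ D := hD ⟨_, ⟨n, rfl⟩, rfl⟩
  linarith

theorem endc_append (c : Config Q Γ) (es es' : List (Edge Q Γ)) :
    endc c (es ++ es') = endc (endc c es) es' :=
  List.foldl_append

theorem WPS.Valid.append {A : WPS Q Γ} {es es' : List (Edge Q Γ)} : ∀ {c : Config Q Γ},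
    A.Valid c es → A.Valid (endc c es) es' → A.Valid c (es ++ es') := by
  induction es with
  | nil => exact fun _ h => h
  | cons e es ih => exact fun h h' => ⟨h.1, ih h.2 h'⟩

theorem WPS.Valid.enabled {A : WPS Q Γ} {es : List (Edge Q Γ)} : ∀ {c : Config Q Γ},
    A.Valid c es → ∀ (i : ℕ) (hi : i < es.length), A.Enabled (endc c (es.take i)) es[i] := by
  induction es with
  | nil => intro c _ i hi; simp at hi
  | cons e es ih =>
    intro c h i hi
    cases i with
    | zero => exact h.1
    | succ i => exact ih h.2 i (by simpa using hi)

theorem Deriv.exists_path {A : WPS Q Γ} {S : Set (Γ × Q × Q)} {K : Γ × Q × Q} {n : ℕ} {w : ℤ}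
    (h : Deriv A S K n w) : ∃ es : List (Edge Q Γ), es.length = n ∧ A.wt es = w ∧
      ∀ α, A.Valid (K.1 :: α, K.2.1) es ∧ endc (K.1 :: α, K.2.1) es = (K.1 :: α, K.2.2) := by
  induction h with
  | nil γ q => exact ⟨[], rfl, rfl, fun α => ⟨trivial, rfl⟩⟩
  | skip he _ _ ih =>
    obtain ⟨es, rfl, rfl, hes⟩ := ih
    refine ⟨_ :: es, rfl, by simp [WPS.wt], fun α => ⟨⟨⟨he, rfl, rfl⟩, (hes α).1⟩, (hes α).2⟩⟩
  | @push γ z q r r' s q' n m v w he he' _ _ _ _ ih1 ih2 =>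
    obtain ⟨es₁, rfl, rfl, h1⟩ := ih1
    obtain ⟨es₂, rfl, rfl, h2⟩ := ih2
    refine ⟨⟨q, γ, r, .push z⟩ :: (es₁ ++ ⟨r', z, s, .pop⟩ :: es₂), by simp; omega,
      by simp [WPS.wt]; ring, fun α => ?_⟩
    obtain ⟨v1, e1⟩ := h1 (γ :: α)
    obtain ⟨v2, e2⟩ := h2 α
    simp only at v1 e1 v2 e2 ⊢
    refine ⟨⟨⟨he, rfl, rfl⟩, WPS.Valid.append v1 ?_⟩, ?_⟩
    · change A.Valid (endc (z :: γ :: α, r) es₁) _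
      rw [e1]
      exact ⟨⟨he', rfl, rfl⟩, v2⟩
    · change endc (z :: γ :: α, r) (es₁ ++ ⟨r', z, s, .pop⟩ :: es₂) = _
      rw [endc_append, e1]
      exact e2

theorem Deriv.exists_stackBounded [Finite Q] [Finite Γ] {A : WPS Q Γ} {γ : Γ} {q : Q} {n : ℕ}
    {w : ℤ} (h : Deriv A Set.univ (γ, q, q) n w) (hn : 0 < n) {a : ℝ} (ha : a * n ≤ w) :
    ∃ (c : Config Q Γ) (f : ℕ → Edge Q Γ), IsConfig c ∧ A.ValidInf c f ∧ StackBounded c f ∧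
      a ≤ LimInfAvg A f := by
  obtain ⟨es, rfl, rfl, hes⟩ := h.exists_path
  obtain ⟨hval, hend⟩ := hes []
  simp only at hval hend
  set c : Config Q Γ := ([γ], q) with hc
  let f : ℕ → Edge Q Γ := fun i => es[i % es.length]'(Nat.mod_lt _ hn)
  have hconf : ∀ i, confs c f i = endc c (es.take (i % es.length)) := by
    intro i
    induction i with
    | zero => simp [confs, endc]
    | succ i ih =>
      have hlt := Nat.mod_lt i hn
      have hstep : confs c f (i + 1) = endc c (es.take (i % es.length + 1)) := by
        rw [List.take_succ_eq_append_getElem hlt, endc_append, ← ih]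
        rfl
      rw [hstep, ← Nat.mod_add_mod]
      rcases (Nat.succ_le_of_lt hlt).eq_or_lt with heq | hlt'
      · rw [← Nat.succ_eq_add_one, heq, Nat.mod_self, List.take_length, List.take_zero, hend]
        rfl
      · rw [Nat.mod_eq_of_lt hlt']
  have hf : ∀ i, f (es.length + i) = f i := fun i => by simp [f]
  refine ⟨c, f, by simp [IsConfig, hc], fun i => ?_, ?_, ?_⟩
  · rw [hconf]
    exact hval.enabled _ _
  · refine ⟨(Finset.range es.length).sup fun r => height (endc c (es.take r)), fun k => ?_⟩
    rw [hconf]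
    exact Finset.le_sup (f := fun r => height (endc c (es.take r)))
      (Finset.mem_range.2 (Nat.mod_lt k hn))
  · have hwt : ∑ i ∈ Finset.range es.length, (A.w (f i) : ℝ) = A.wt es := by
      rw [Finset.sum_range]
      have : ∀ i : Fin es.length, f i = es[i] := fun i => by simp [f, Nat.mod_eq_of_lt i.2]
      simp only [this]
      rw [WPS.wt, ← Fin.sum_univ_fun_getElem]
      push_cast
      rfl
    obtain ⟨D, hD⟩ := ((Set.finite_Iio es.length).image fun r : ℕ =>
      ∑ i ∈ Finset.range r, (A.w (f i) : ℝ) - a * r).bddBelow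
    refine le_limInfAvg (D := D) fun N => ?_
    induction N using Nat.strong_induction_on with
    | _ N ih =>
      rcases lt_or_ge N es.length with hN | hN
      · have : D ≤ ∑ i ∈ Finset.range N, (A.w (f i) : ℝ) - a * N := hD ⟨N, hN, rfl⟩
        linarith
      · obtain ⟨N, rfl⟩ := Nat.exists_eq_add_of_le hN
        have := ih N (by omega)
        rw [Finset.sum_range_add, hwt]
        simp only [hf]
        push_cast
        linarith

theorem two_pow_le_bound {a b : ℕ} (ha : 0 < a) (hb : 0 < b) :
    2 ^ (a * (b * b) + 1) ≤ (a * b) ^ ((a * b + 1) ^ 2) * (2 * (a * b)) + 2 := by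
  rcases Nat.lt_or_ge 1 (a * b) with h | h
  · have hle : a * (b * b) ≤ (a * b + 1) ^ 2 := by 
      nlinarith [Nat.mul_le_mul (Nat.mul_le_mul ha (le_refl a)) (le_refl (b * b))]
    have h1 : 2 ^ (a * (b * b)) ≤ (a * b) ^ ((a * b + 1) ^ 2) :=
      (Nat.pow_le_pow_left h _).trans (Nat.pow_le_pow_right (by omega) hle)
    rw [pow_succ]
    nlinarith [Nat.mul_le_mul h1 (by omega : 2 ≤ 2 * (a * b))]
  · have hab : a * b = 1 := le_antisymm h (Nat.mul_pos ha hb)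
    obtain ⟨rfl, rfl⟩ := mul_eq_one.1 hab
    norm_num

/-- A stack bounded path with limsup-average above the threshold gives stack bounded paths with
liminf-average arbitrarily close to `0` from below. -/
theorem exists_neg_le_limInfAvg [Fintype Q] [Fintype Γ] {A : WPS Q Γ} {c : Config Q Γ}
    {f : ℕ → Edge Q Γ} (hv : A.ValidInf c f) (hb : StackBounded c f)
    (h : -(1 / (((Fintype.card Γ * Fintype.card Q : ℕ) : ℝ) ^
              ((Fintype.card Γ * Fintype.card Q + 1) ^ 2) *
            (2 * ((Fintype.card Γ * Fintype.card Q : ℕ) : ℝ)))) < LimSupAvg A f)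
    {δ : ℝ} (hδ : 0 < δ) :
    ∃ (c : Config Q Γ) (f : ℕ → Edge Q Γ), IsConfig c ∧ A.ValidInf c f ∧ StackBounded c f ∧
      -δ ≤ LimInfAvg A f := by
  obtain ⟨γ, q, n, w, hd, hw⟩ := exists_cycle_of_lt_limSupAvg hv hb h
  have hΓ : 0 < Fintype.card Γ := Fintype.card_pos_iff.2 ⟨γ⟩
  have hQ : 0 < Fintype.card Q := Fintype.card_pos_iff.2 ⟨q⟩
  have hbound := two_pow_le_bound hΓ hQ
  have hcard : Nat.card (Γ × Q × Q) = Fintype.card Γ * (Fintype.card Q * Fintype.card Q) := by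
    simp
  rw [← hcard] at hbound
  set ℓ := Fintype.card Γ * Fintype.card Q
  have hℓ : 0 < ℓ := Nat.mul_pos hΓ hQ
  obtain ⟨B, hB⟩ : ∃ B, B + 2 = 2 ^ (Nat.card (Γ × Q × Q) + 1) :=
    ⟨_, Nat.sub_add_cancel (by
      rw [pow_succ]
      exact Nat.le_mul_of_pos_left 2 (by positivity))⟩
  set T : ℝ := (ℓ : ℝ) ^ ((ℓ + 1) ^ 2) * (2 * (ℓ : ℝ)) with hT
  have hTpos : 0 < T := by positivity
  have hBT : (B : ℝ) ≤ T := by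
    have : B ≤ ℓ ^ ((ℓ + 1) ^ 2) * (2 * ℓ) := by omega
    rw [hT]
    exact_mod_cast this
  have hTw : 0 < T * w + n := by
    have := mul_lt_mul_of_pos_left hw hTpos
    have e : T * (-(1 / T) * n) = -n := by field_simp
    linarith
  have hBw : 0 < (B : ℤ) * w + n := by
    rcases le_or_gt 0 w with hw0 | hw0
    · rcases Nat.eq_zero_or_pos n with rfl | hn
      · simp [hd.weight_eq_zero] at hTw
      · positivity
    · have hw0' : (w : ℝ) < 0 := by exact_mod_cast hw0
      have : 0 < (B : ℝ) * w + n := by nlinarith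
      exact_mod_cast this
  obtain ⟨n', w', hn', hd', hw'⟩ := exists_cycle_avg_ge hB hd hBw hδ
  exact hd'.exists_stackBounded hn' hw'

/-- The shared form of the two equivalences, for a mean-payoff value `L`. -/
theorem exists_lt_iff_zero_le_sSup {P : Config Q Γ → (ℕ → Edge Q Γ) → Prop}
    {L : (ℕ → Edge Q Γ) → ℝ} {ε : ℝ} (hε : ∀ c f, P c f → 0 < ε)
    (h : ∀ c f, P c f → -ε < L f → ∀ δ : ℝ, 0 < δ → ∃ c f, P c f ∧ -δ ≤ L f) :
    (∃ c f, P c f ∧ -ε < L f) ↔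
      (0 : EReal) ≤ sSup {x : EReal | ∃ c f, P c f ∧ x = ((L f : ℝ) : EReal)} := by
  constructor
  · rintro ⟨c, f, hP, hL⟩
    by_contra! hlt
    obtain ⟨r, hr1, hr2⟩ := EReal.lt_iff_exists_real_btwn.1 hlt
    obtain ⟨c', f', hP', hL'⟩ := h c f hP hL (-r) (by
      have : r < 0 := by exact_mod_cast hr2
      linarith)
    refine hr1.not_ge (le_trans ?_ (le_sSup ⟨c', f', hP', rfl⟩))
    rw [neg_neg] at hL'
    exact_mod_cast hL'
  · intro h0
    obtain ⟨c, f, hP⟩ : ∃ c f, P c f := by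
      by_contra! hcon
      simp [hcon] at h0
    have hneg : ((-ε : ℝ) : EReal) < 0 := by
      have := hε c f hP
      exact_mod_cast (by linarith : -ε < 0)
    obtain ⟨_, ⟨c', f', hP', rfl⟩, hlt⟩ := lt_sSup_iff.1 (hneg.trans_le h0)
    exact ⟨c', f', hP', by exact_mod_cast hlt⟩

end PDS

open PDS in
/-- with `ℓ = |Γ|·|Q|` and `ε = 1/(ℓ^{(ℓ+1)²}·2ℓ)`, a stack bounded
infinite path with liminf-average `> -ε` exists iff the supremum (in `EReal`) of the
liminf-averages over all stack bounded infinite paths is at least `0`; and the same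
holds with limsup-average in place of liminf-average. -/
theorem stack_bounded_sup_mean_payoff
    {Q Γ : Type} [Fintype Q] [Fintype Γ] (A : WPS Q Γ) :
    ((∃ (c : Config Q Γ) (f : ℕ → Edge Q Γ), IsConfig c ∧ A.ValidInf c f ∧
        StackBounded c f ∧
        -(1 / (((Fintype.card Γ * Fintype.card Q : ℕ) : ℝ) ^
              ((Fintype.card Γ * Fintype.card Q + 1) ^ 2) *
            (2 * ((Fintype.card Γ * Fintype.card Q : ℕ) : ℝ)))) < LimInfAvg A f) ↔
      (0 : EReal) ≤ sSup { x : EReal | ∃ (c : Config Q Γ) (f : ℕ → Edge Q Γ),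
        IsConfig c ∧ A.ValidInf c f ∧ StackBounded c f ∧ x = ((LimInfAvg A f : ℝ) : EReal) }) ∧
    ((∃ (c : Config Q Γ) (f : ℕ → Edge Q Γ), IsConfig c ∧ A.ValidInf c f ∧
        StackBounded c f ∧
        -(1 / (((Fintype.card Γ * Fintype.card Q : ℕ) : ℝ) ^
              ((Fintype.card Γ * Fintype.card Q + 1) ^ 2) *
            (2 * ((Fintype.card Γ * Fintype.card Q : ℕ) : ℝ)))) < LimSupAvg A f) ↔
      (0 : EReal) ≤ sSup { x : EReal | ∃ (c : Config Q Γ) (f : ℕ → Edge Q Γ),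
        IsConfig c ∧ A.ValidInf c f ∧ StackBounded c f ∧ x = ((LimSupAvg A f : ℝ) : EReal) }) := by
  have threshold_pos : ∀ f : ℕ → Edge Q Γ,
      0 < 1 / (((Fintype.card Γ * Fintype.card Q : ℕ) : ℝ) ^
              ((Fintype.card Γ * Fintype.card Q + 1) ^ 2) *
            (2 * ((Fintype.card Γ * Fintype.card Q : ℕ) : ℝ))) := fun f => by
    have hℓ : 0 < Fintype.card Γ * Fintype.card Q :=
      Nat.mul_pos (Fintype.card_pos_iff.2 ⟨(f 0).top⟩) (Fintype.card_pos_iff.2 ⟨(f 0).q1⟩)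
    positivity
  constructor
  · have := exists_lt_iff_zero_le_sSup
      (P := fun c f => IsConfig c ∧ A.ValidInf c f ∧ StackBounded c f) (L := LimInfAvg A)
      (fun _ f _ => threshold_pos f) fun c f ⟨_, hv, hb⟩ hL δ hδ => by
        obtain ⟨c', f', h1, h2, h3, h4⟩ := exists_neg_le_limInfAvg hv hb
          (hL.trans_le (limInfAvg_le_limSupAvg A f)) hδ
        exact ⟨c', f', ⟨h1, h2, h3⟩, h4⟩
    simpa only [and_assoc] using this
  · have := exists_lt_iff_zero_le_sSup
      (P := fun c f => IsConfig c ∧ A.ValidInf c f ∧ StackBounded c f) (L := LimSupAvg A)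
      (fun _ f _ => threshold_pos f) fun c f ⟨_, hv, hb⟩ hL δ hδ => by
        obtain ⟨c', f', h1, h2, h3, h4⟩ := exists_neg_le_limInfAvg hv hb hL hδ
        exact ⟨c', f', ⟨h1, h2, h3⟩, h4.trans (limInfAvg_le_limSupAvg A f')⟩
    simpa only [and_assoc] using this
end

section
/- Let (G, ν⃗) be a signature game on a finite two-player game graph G with maximal absolute integer edge weight W and vertex set V, such that every integer coefficient ν_i of the threshold vector satisfies ν_i ≥ −2·W·|V|. Then player 1 has a winning strategy in the signature game (G, ν⃗) if and only if player 1 has a memoryless winning strategy in (G, ν⃗). -/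
open scoped BigOperators

namespace SigGame

/-- A signature game: a finite two-player game graph with edge weights in
`ℤ ∪ {-ω}` (modelled as `WithBot ℤ`, with the convention `-ω + z = -ω`), an initial
vertex, and a threshold vector `ν` with values in `ℤ ∪ {+∞, -ω}` (modelled inside
`EReal`, where `⊤ = +∞` and `⊥ = -ω`). -/
structure SG (V : Type) where
  E : V → V → Prop
  P1 : V → Prop
  w : V → V → WithBot ℤ
  v0 : V
  nu : V → EReal

variable {V : Type}

/-- Interpretation of a weight in `ℤ ∪ {-ω}` inside `EReal`. -/
noncomputable def toE (x : WithBot ℤ) : EReal :=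
  WithBot.recBotCoe (⊥ : EReal) (fun z => ((z : ℝ) : EReal)) x

/-- An infinite play of the game. -/
def SG.IsPlay (G : SG V) (ρ : ℕ → V) : Prop :=
  ρ 0 = G.v0 ∧ ∀ n, G.E (ρ n) (ρ (n + 1))

/-- Weight (in `WithBot ℤ`, with `⊥ = -ω` absorbing) of the segment of the play `ρ`
from position `i` to position `j`. -/
def SG.segW (G : SG V) (ρ : ℕ → V) (i j : ℕ) : WithBot ℤ :=
  ∑ k ∈ Finset.Ico i j, G.w (ρ k) (ρ (k + 1))

/-- Player 1 wins the play `ρ`: no cycle along the play has negative weight or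
contains a `-ω`-edge, and every prefix weight meets the threshold of the vertex
reached (under the convention `-ω < z < +∞`). -/
def SG.P1Wins (G : SG V) (ρ : ℕ → V) : Prop :=
  (∀ i j, i < j → ρ i = ρ j → (0 : WithBot ℤ) ≤ G.segW ρ i j) ∧
  (∀ j, G.nu (ρ j) ≤ toE (G.segW ρ 0 j))

/-- A player-1 strategy: given the past history and the current vertex, choose the
next vertex. -/
abbrev Strat (V : Type) := List V → V → V

/-- The strategy proposes edges of the graph whenever the current vertex belongs to
player 1 and has a successor. -/
def SG.ValidStrat (G : SG V) (σ : Strat V) : Prop :=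
  ∀ (h : List V) (c : V), G.P1 c → (∃ c', G.E c c') → G.E c (σ h c)

/-- A play consistent with the strategy `σ` of player 1. -/
def SG.Consistent (G : SG V) (σ : Strat V) (ρ : ℕ → V) : Prop :=
  G.IsPlay ρ ∧
    ∀ n, G.P1 (ρ n) → ρ (n + 1) = σ (List.ofFn (fun i : Fin n => ρ i)) (ρ n)

/-- A winning strategy for player 1 in the signature game. -/
def SG.WinningStrat (G : SG V) (σ : Strat V) : Prop :=
  G.ValidStrat σ ∧ ∀ ρ, G.Consistent σ ρ → G.P1Wins ρ

/-- A memoryless strategy depends only on the current vertex. -/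
def Memoryless (σ : Strat V) : Prop :=
  ∀ (h₁ h₂ : List V) (c : V), σ h₁ c = σ h₂ c

end SigGame

namespace SigGame

variable {V : Type}

/-- The `n`-th stage of player 1's attractor to the vertices without successor. -/
def SG.deadEndAttractor (G : SG V) : ℕ → V → Prop
  | 0, u => ∀ v, ¬ G.E u v
  | n + 1, u => G.deadEndAttractor n u ∨
      (G.P1 u ∧ ∃ v, G.E u v ∧ G.deadEndAttractor n v) ∨
      (¬ G.P1 u ∧ ∀ v, G.E u v → G.deadEndAttractor n v)

/-- Player 1 can force the play into a vertex without successor. -/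
def SG.ForcesDeadEnd (G : SG V) (u : V) : Prop := ∃ n, G.deadEndAttractor n u

lemma SG.deadEndAttractor_mono (G : SG V) (u : V) :
    Monotone fun n => G.deadEndAttractor n u :=
  monotone_nat_of_le_succ fun _ h => Or.inl h

lemma SG.exists_succ_of_not_forcesDeadEnd (G : SG V) {u : V} (hu : ¬ G.ForcesDeadEnd u) :
    ∃ v, G.E u v := by
  by_contra! h
  exact hu ⟨0, h⟩

lemma SG.not_forcesDeadEnd_succ (G : SG V) {u v : V} (hu : ¬ G.ForcesDeadEnd u)
    (hP : G.P1 u) (huv : G.E u v) : ¬ G.ForcesDeadEnd v :=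
  fun ⟨n, hn⟩ => hu ⟨n + 1, Or.inr (Or.inl ⟨hP, v, huv, hn⟩)⟩

lemma SG.exists_succ_not_forcesDeadEnd [Fintype V] (G : SG V) {u : V}
    (hu : ¬ G.ForcesDeadEnd u) : ∃ v, G.E u v ∧ ¬ G.ForcesDeadEnd v := by
  by_cases hP : G.P1 u
  · obtain ⟨v, hv⟩ := G.exists_succ_of_not_forcesDeadEnd hu
    exact ⟨v, hv, G.not_forcesDeadEnd_succ hu hP hv⟩
  · by_contra! h
    have h' : ∀ v, ∃ n, G.E u v → G.deadEndAttractor n v := fun v => by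
      by_cases hv : G.E u v
      · obtain ⟨n, hn⟩ := h v hv
        exact ⟨n, fun _ => hn⟩
      · exact ⟨0, fun h => absurd h hv⟩
    choose f hf using h'
    exact hu ⟨Finset.univ.sup f + 1, Or.inr (Or.inr ⟨hP, fun v hv =>
      G.deadEndAttractor_mono v (Finset.le_sup (Finset.mem_univ v)) (hf v hv)⟩)⟩

lemma SG.exists_attractor_move (G : SG V) : ∃ (r : V → ℕ) (τ : V → V), ∀ u, G.ForcesDeadEnd u →
    (G.P1 u → (∃ v, G.E u v) → G.E u (τ u)) ∧
    ∀ v, G.E u v → (G.P1 u → v = τ u) → G.ForcesDeadEnd v ∧ r v < r u := by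
  classical
  let r : V → ℕ := fun u => if h : G.ForcesDeadEnd u then Nat.find h else 0
  have hle : ∀ n v, G.deadEndAttractor n v → r v ≤ n := fun n v hn => by
    have h : G.ForcesDeadEnd v := ⟨n, hn⟩
    simp only [r, dif_pos h]
    exact Nat.find_min' h hn
  have key : ∀ u, ∃ x, G.ForcesDeadEnd u → (G.P1 u → (∃ v, G.E u v) → G.E u x) ∧
      ∀ v, G.E u v → (G.P1 u → v = x) → G.ForcesDeadEnd v ∧ r v < r u := by
    intro u
    by_cases h : G.ForcesDeadEnd u
    swap
    · exact ⟨u, fun h' => absurd h' h⟩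
    have hr : r u = Nat.find h := dif_pos h
    have hspec := Nat.find_spec h
    have hmin := fun m => Nat.find_min h (m := m)
    rw [← hr] at hspec hmin
    rcases hk : r u with _ | k
    · rw [hk] at hspec
      exact ⟨u, fun _ => ⟨fun _ ⟨v, hv⟩ => absurd hv (hspec v), fun v hv => absurd hv (hspec v)⟩⟩
    · rw [hk] at hspec hmin
      rcases hspec with h1 | ⟨hP, x, hx, hxk⟩ | ⟨hP, hall⟩
      · exact absurd h1 (hmin k (Nat.lt_succ_self k))
      · refine ⟨x, fun _ => ⟨fun _ _ => hx, fun v _ hvx => ?_⟩⟩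
        rw [hvx hP]
        exact ⟨⟨k, hxk⟩, Nat.lt_succ_of_le (hle k x hxk)⟩
      · exact ⟨u, fun _ => ⟨fun h => absurd h hP, fun v hv _ =>
          ⟨⟨k, hall v hv⟩, Nat.lt_succ_of_le (hle k v (hall v hv))⟩⟩⟩
  choose τ hτ using key
  exact ⟨r, τ, hτ⟩

/-- Continue the finite sequence `g 0, …, g n` by repeatedly applying `next` to the history and
the current vertex. -/
def continuation (g : ℕ → V) (n : ℕ) (next : List V → V → V) : ℕ → V
  | 0 => g 0
  | i + 1 => if i + 1 ≤ n then g (i + 1) else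
      next (List.ofFn fun j : Fin i => continuation g n next j.1) (continuation g n next i)

lemma continuation_of_le (g : ℕ → V) (n : ℕ) (next : List V → V → V) {i : ℕ} (hi : i ≤ n) :
    continuation g n next i = g i := by
  cases i with
  | zero => rw [continuation]
  | succ i => rw [continuation, if_pos hi]

lemma continuation_succ (g : ℕ → V) (n : ℕ) (next : List V → V → V) {i : ℕ} (hi : n ≤ i) :
    continuation g n next (i + 1) =
      next (List.ofFn fun j : Fin i => continuation g n next j) (continuation g n next i) := by
  rw [continuation, if_neg (by omega)]

lemma SG.exists_consistent_continuation [Fintype V] (G : SG V) {σ : Strat V}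
    (hσ : G.ValidStrat σ) (g : ℕ → V) (n : ℕ) (hg : ¬ G.ForcesDeadEnd (g n)) :
    ∃ ρ : ℕ → V, (∀ i ≤ n, ρ i = g i) ∧ ∀ k ≥ n, G.E (ρ k) (ρ (k + 1)) ∧
      (G.P1 (ρ k) → ρ (k + 1) = σ (List.ofFn fun i : Fin k => ρ i) (ρ k)) := by
  classical
  have h : ∀ u, ∃ v, ¬ G.ForcesDeadEnd u → G.E u v ∧ ¬ G.ForcesDeadEnd v := fun u => by
    by_cases hu : G.ForcesDeadEnd u
    · exact ⟨u, fun h => absurd hu h⟩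
    · obtain ⟨v, hv⟩ := G.exists_succ_not_forcesDeadEnd hu
      exact ⟨v, fun _ => hv⟩
  choose s hs using h
  let next : List V → V → V := fun l u => if G.P1 u then σ l u else s u
  have hnext : ∀ l u, ¬ G.ForcesDeadEnd u → G.E u (next l u) ∧ ¬ G.ForcesDeadEnd (next l u) := by
    intro l u hu
    by_cases hP : G.P1 u
    · have hE := hσ l u hP (G.exists_succ_of_not_forcesDeadEnd hu)
      simp only [next, if_pos hP]
      exact ⟨hE, G.not_forcesDeadEnd_succ hu hP hE⟩
    · simp only [next, if_neg hP]
      exact hs u hu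
  have hlive : ∀ k ≥ n, ¬ G.ForcesDeadEnd (continuation g n next k) := by
    intro k hk
    induction k, hk using Nat.le_induction with
    | base => rwa [continuation_of_le g n next le_rfl]
    | succ k hk ih =>
      rw [continuation_succ g n next hk]
      exact (hnext _ _ ih).2
  refine ⟨continuation g n next, fun i hi => continuation_of_le g n next hi, fun k hk => ?_⟩
  have hsucc := continuation_succ g n next hk
  refine ⟨?_, fun hP => ?_⟩
  · rw [hsucc]
    exact (hnext _ _ (hlive k hk)).1
  · rw [hsucc]
    simp only [next, if_pos hP]

lemma SG.exists_consistent [Fintype V] (G : SG V) {σ : Strat V} (hσ : G.ValidStrat σ)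
    (h0 : ¬ G.ForcesDeadEnd G.v0) : ∃ ρ, G.Consistent σ ρ := by
  obtain ⟨ρ, h1, h2⟩ := G.exists_consistent_continuation hσ (fun _ => G.v0) 0 h0
  exact ⟨ρ, ⟨h1 0 le_rfl, fun n => (h2 n n.zero_le).1⟩, fun n => (h2 n n.zero_le).2⟩

lemma SG.Consistent.exists_deviation [Fintype V] {G : SG V} {σ : Strat V}
    (hσ : G.ValidStrat σ) {ρ : ℕ → V} (hρ : G.Consistent σ ρ) {n : ℕ} (hP : ¬ G.P1 (ρ n)) {v : V}
    (hE : G.E (ρ n) v) (hv : ¬ G.ForcesDeadEnd v) :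
    ∃ ρ', G.Consistent σ ρ' ∧ (∀ i ≤ n, ρ' i = ρ i) ∧ ρ' (n + 1) = v := by
  obtain ⟨ρ', h1, h2⟩ := G.exists_consistent_continuation hσ (Function.update ρ (n + 1) v) (n + 1)
    (by simpa using hv)
  have hle : ∀ i ≤ n, ρ' i = ρ i := fun i hi => by
    rw [h1 i (by omega), Function.update_of_ne (by omega)]
  have hlast : ρ' (n + 1) = v := by rw [h1 (n + 1) le_rfl, Function.update_self]
  have hstep : ∀ k, G.E (ρ' k) (ρ' (k + 1)) ∧
      (G.P1 (ρ' k) → ρ' (k + 1) = σ (List.ofFn fun i : Fin k => ρ' i) (ρ' k)) := by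
    intro k
    rcases lt_trichotomy k n with hk | rfl | hk
    · rw [hle k hk.le, hle (k + 1) hk]
      refine ⟨hρ.1.2 k, fun hPk => ?_⟩
      have hl : (fun i : Fin k => ρ' i) = fun i : Fin k => ρ i :=
        funext fun i => hle i (by omega)
      rw [hl]
      exact hρ.2 k hPk
    · rw [hlast, hle k le_rfl]
      exact ⟨hE, fun h => absurd h hP⟩
    · exact h2 k hk
  exact ⟨ρ', ⟨⟨(hle 0 n.zero_le).trans hρ.1.1, fun k => (hstep k).1⟩, fun k => (hstep k).2⟩,
    hle, hlast⟩

/-- A sequence of integers that never decreases between two visits of the same vertex and drops by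
at most `C` in each step drops by at most `C * |V|` altogether. -/
lemma le_add_mul_card [Fintype V] (π : ℕ → V) (f : ℕ → ℤ) {C : ℤ} (hC : 0 ≤ C)
    (hcyc : ∀ i j, i ≤ j → π i = π j → f i ≤ f j) (hstep : ∀ k, f k ≤ f (k + 1) + C)
    {a n : ℕ} (han : a ≤ n) : f a ≤ f n + C * Fintype.card V := by
  classical
  have key : ∀ (T : Finset V) (a : ℕ), a ≤ n → (∀ k, a ≤ k → k ≤ n → π k ∈ T) →
      f a ≤ f n + C * T.card := by
    intro T
    induction T using Finset.strongInduction with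
    | H T ih =>
      intro a han hT
      let b := Nat.findGreatest (fun k => a ≤ k ∧ π k = π a) n
      have hb : a ≤ b ∧ π b = π a :=
        Nat.findGreatest_spec (P := fun k => a ≤ k ∧ π k = π a) han ⟨le_rfl, rfl⟩
      have hbn : b ≤ n := Nat.findGreatest_le n
      have hab := hcyc a b hb.1 hb.2.symm
      have ha := hT a le_rfl han
      rcases hbn.eq_or_lt with hbn | hbn
      · rw [hbn] at hab
        have : 0 ≤ C * T.card := by positivity
        omega
      · have hrest := ih (T.erase (π a)) (Finset.erase_ssubset ha) (b + 1) hbn fun k hk hkn =>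
          Finset.mem_erase.2 ⟨fun h => Nat.findGreatest_is_greatest
            (P := fun k => a ≤ k ∧ π k = π a) (n := n) (k := k) (by exact hk) hkn
              ⟨by omega, h⟩, hT k (by omega) hkn⟩
        have hcard : (T.card : ℤ) = (T.erase (π a)).card + 1 := by
          exact_mod_cast (Finset.card_erase_add_one ha).symm
        have := hstep b
        rw [hcard, mul_add, mul_one]
        omega
  exact key Finset.univ a han fun k _ _ => Finset.mem_univ _

/-- The weight of the first `n` edges of `ρ`, where `-ω` is replaced by `-M`. -/
def SG.prefixW (G : SG V) (M : ℤ) (ρ : ℕ → V) (n : ℕ) : ℤ :=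
  ∑ k ∈ Finset.range n, (G.w (ρ k) (ρ (k + 1))).unbotD (-M)

lemma SG.prefixW_succ (G : SG V) (M : ℤ) (ρ : ℕ → V) (n : ℕ) :
    G.prefixW M ρ (n + 1) = G.prefixW M ρ n + (G.w (ρ n) (ρ (n + 1))).unbotD (-M) :=
  Finset.sum_range_succ _ _

lemma SG.prefixW_congr (G : SG V) (M : ℤ) {ρ ρ' : ℕ → V} {n : ℕ} (h : ∀ i ≤ n, ρ i = ρ' i) :
    G.prefixW M ρ n = G.prefixW M ρ' n := by
  refine Finset.sum_congr rfl fun k hk => ?_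
  have := Finset.mem_range.1 hk
  rw [h k (by omega), h (k + 1) (by omega)]

lemma SG.segW_eq (G : SG V) (M : ℤ) (ρ : ℕ → V) {i j : ℕ} (hij : i ≤ j)
    (h : ∀ k, i ≤ k → k < j → G.w (ρ k) (ρ (k + 1)) ≠ ⊥) :
    G.segW ρ i j = ((G.prefixW M ρ j - G.prefixW M ρ i : ℤ) : WithBot ℤ) := by
  induction j, hij using Nat.le_induction with
  | base => simp [SG.segW]
  | succ j hij ih =>
    have hw := h j hij j.lt_succ_self
    have ih := ih fun k hk hkj => h k hk (hkj.trans j.lt_succ_self)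
    rw [SG.segW] at ih ⊢
    rw [Finset.sum_Ico_succ_top hij, ih, G.prefixW_succ]
    obtain ⟨z, hz⟩ := WithBot.ne_bot_iff_exists.1 hw
    rw [← hz, WithBot.unbotD_coe, ← WithBot.coe_add, WithBot.coe_inj]
    ring

lemma SG.weight_ne_bot_of_segW (G : SG V) {ρ : ℕ → V} {i j : ℕ} (h : G.segW ρ i j ≠ ⊥) {k : ℕ}
    (hik : i ≤ k) (hkj : k < j) : G.w (ρ k) (ρ (k + 1)) ≠ ⊥ := by
  intro hk
  apply h
  rw [SG.segW, WithBot.sum_eq_bot_iff]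
  exact ⟨k, Finset.mem_Ico.2 ⟨hik, hkj⟩, hk⟩

lemma SG.P1Wins.prefixW_le {G : SG V} {ρ : ℕ → V} (h : G.P1Wins ρ) (M : ℤ) {i j : ℕ}
    (hij : i ≤ j) (he : ρ i = ρ j) : G.prefixW M ρ i ≤ G.prefixW M ρ j := by
  rcases hij.eq_or_lt with rfl | hlt
  · exact le_rfl
  have h0 := h.1 i j hlt he
  have hne : G.segW ρ i j ≠ ⊥ := fun hb => by simp [hb] at h0
  rw [G.segW_eq M ρ hij fun k h1 h2 => G.weight_ne_bot_of_segW hne h1 h2] at h0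
  have : (0 : ℤ) ≤ G.prefixW M ρ j - G.prefixW M ρ i := WithBot.coe_le_coe.1 h0
  omega

lemma toE_coe (z : ℤ) : toE (z : WithBot ℤ) = ((z : ℝ) : EReal) := rfl

lemma toE_bot : toE ⊥ = ⊥ := rfl

lemma SG.P1Wins.le_prefixW {G : SG V} {ρ : ℕ → V} (h : G.P1Wins ρ) (M : ℤ) {n : ℕ} {z : ℤ}
    (hz : G.nu (ρ n) = ((z : ℝ) : EReal)) : z ≤ G.prefixW M ρ n := by
  have h0 := h.2 n
  have hne : G.segW ρ 0 n ≠ ⊥ := fun hb => by simp [hb, hz, toE_bot] at h0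
  rw [G.segW_eq M ρ n.zero_le fun k h1 h2 => G.weight_ne_bot_of_segW hne h1 h2, toE_coe, hz,
    EReal.coe_le_coe_iff, Int.cast_le] at h0
  simpa [SG.prefixW] using h0

lemma toE_ne_top (x : WithBot ℤ) : toE x ≠ ⊤ := by
  induction x using WithBot.recBotCoe with
  | bot => simp [toE_bot]
  | coe z => simp [toE_coe]

/-- A sequence of vertices along which a potential bounded below by the thresholds increases by at
most the weight of each edge, with `-ω` standing for a sufficiently negative number, is won by
player 1. -/
lemma SG.p1Wins_of_potential [Fintype V] (G : SG V) {W : ℕ} {M : ℤ}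
    (hM : 4 * (W : ℤ) * Fintype.card V < M)
    (hnuRange : ∀ v : V, G.nu v = ⊤ ∨ G.nu v = ⊥ ∨ ∃ z : ℤ, G.nu v = ((z : ℝ) : EReal))
    (hnuLB : ∀ (v : V) (z : ℤ), G.nu v = ((z : ℝ) : EReal) →
      -(2 * (W : ℤ) * (Fintype.card V : ℤ)) ≤ z)
    {π : ℕ → V} {e : V → ℤ} (he0 : e (π 0) ≤ 0)
    (hupper : ∀ k, (G.w (π k) (π (k + 1))).unbotD (-M) ≤ W)
    (hstep : ∀ k, e (π (k + 1)) ≤ e (π k) + (G.w (π k) (π (k + 1))).unbotD (-M))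
    (htop : ∀ k, G.nu (π k) ≠ ⊤)
    (hnu : ∀ k (z : ℤ), G.nu (π k) = ((z : ℝ) : EReal) → z ≤ e (π k)) : G.P1Wins π := by
  have hbound : ∀ i j, i ≤ j → e (π j) ≤ e (π i) + W * Fintype.card V := fun i j hij => by
    have := le_add_mul_card π (fun k => -e (π k)) (C := W) (by positivity)
      (fun i j _ h => by simp [h]) (fun k => by have := hstep k; have := hupper k; omega) hij
    omega
  have hpos : 0 ≤ (W : ℤ) * Fintype.card V := by positivity
  rw [mul_assoc] at hM
  have hdrop : ∀ i k j, i ≤ k → k < j → G.w (π k) (π (k + 1)) = ⊥ →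
      e (π j) < e (π i) - 2 * (W * Fintype.card V) := fun i k j hik hkj hk => by
    have h1 := hbound i k hik
    have h2 := hbound (k + 1) j hkj
    have h3 := hstep k
    rw [hk, WithBot.unbotD_bot] at h3
    omega
  have hsum : ∀ i j, i ≤ j → e (π j) - e (π i) ≤ G.prefixW M π j - G.prefixW M π i := by
    intro i j hij
    induction j, hij using Nat.le_induction with
    | base => simp
    | succ j hij ih =>
      have := hstep j
      rw [G.prefixW_succ]
      omega
  refine ⟨fun i j hij hcyc => ?_, fun j => ?_⟩
  · rw [G.segW_eq M π hij.le fun k h1 h2 h3 => ?_]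
    · have := hsum i j hij.le
      rw [hcyc] at this
      exact WithBot.coe_le_coe.2 (by omega : (0 : ℤ) ≤ _)
    · have := hdrop i k j h1 h2 h3
      rw [hcyc] at this
      omega
  · rcases hnuRange (π j) with h | h | ⟨z, h⟩
    · exact absurd h (htop j)
    · rw [h]
      exact bot_le
    · have hz := hnu j z h
      have hlb := hnuLB (π j) z h
      rw [mul_assoc] at hlb
      rw [G.segW_eq M π j.zero_le fun k h1 h2 h3 => ?_, h, toE_coe, EReal.coe_le_coe_iff,
        Int.cast_le]
      · have := hsum 0 j j.zero_le
        omega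
      · have := hdrop 0 k j h1 h2 h3
        omega

lemma SG.WinningStrat.exists_memoryless [Fintype V] {G : SG V} {W : ℕ}
    (hWbound : ∀ (u v : V) (z : ℤ), G.E u v → G.w u v = (z : WithBot ℤ) → z.natAbs ≤ W)
    (hnuRange : ∀ v : V, G.nu v = ⊤ ∨ G.nu v = ⊥ ∨ ∃ z : ℤ, G.nu v = ((z : ℝ) : EReal))
    (hnuLB : ∀ (v : V) (z : ℤ), G.nu v = ((z : ℝ) : EReal) →
      -(2 * (W : ℤ) * (Fintype.card V : ℤ)) ≤ z)
    {σ : Strat V} (hσ : G.WinningStrat σ) :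
    ∃ τ : Strat V, Memoryless τ ∧ G.WinningStrat τ := by
  classical
  obtain ⟨M, hM, hWM⟩ : ∃ M : ℤ, 4 * (W : ℤ) * Fintype.card V < M ∧ (W : ℤ) ≤ M := by
    have h1 : 0 ≤ 4 * (W : ℤ) * Fintype.card V := by positivity
    exact ⟨4 * (W : ℤ) * Fintype.card V + W + 1, by omega, by omega⟩
  have hweight : ∀ u v, G.E u v →
      -M ≤ (G.w u v).unbotD (-M) ∧ (G.w u v).unbotD (-M) ≤ W := by
    intro u v huv
    rcases hz : G.w u v with _ | z
    · exact ⟨le_rfl, (by omega : -M ≤ (W : ℤ))⟩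
    · have := hWbound u v z huv hz
      exact ⟨(by omega : -M ≤ z), (by omega : z ≤ W)⟩
  let Visited : V → Prop := fun v => ∃ ρ n, G.Consistent σ ρ ∧ ρ n = v
  have hmin : ∀ v, ∃ (ρ : ℕ → V) (n : ℕ), Visited v → G.Consistent σ ρ ∧ ρ n = v ∧
      ∀ ρ' n', G.Consistent σ ρ' → ρ' n' = v → G.prefixW M ρ n ≤ G.prefixW M ρ' n' := by
    intro v
    by_cases hv : Visited v
    swap
    · exact ⟨fun _ => v, 0, fun h => absurd h hv⟩
    obtain ⟨z, ⟨ρ, n, hρ, hn, hz⟩, hleast⟩ := Int.exists_least_of_bdd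
      (P := fun z => ∃ ρ n, G.Consistent σ ρ ∧ ρ n = v ∧ G.prefixW M ρ n = z)
      ⟨-(M * Fintype.card V), by
        rintro _ ⟨ρ, n, hρ, -, rfl⟩
        have := le_add_mul_card ρ (G.prefixW M ρ) (C := M) (by omega)
          (fun i j => (hσ.2 ρ hρ).prefixW_le M)
          (fun k => by
            have := (hweight _ _ (hρ.1.2 k)).1
            rw [G.prefixW_succ]
            omega) n.zero_le
        rw [show G.prefixW M ρ 0 = 0 from rfl] at this
        omega⟩
      (by
        obtain ⟨ρ, n, hρ, hn⟩ := hv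
        exact ⟨_, ρ, n, hρ, hn, rfl⟩)
    exact ⟨ρ, n, fun _ => ⟨hρ, hn, fun ρ' n' h1 h2 => hz ▸ hleast _ ⟨ρ', n', h1, h2, rfl⟩⟩⟩
  choose ρ n hρn using hmin
  let e : V → ℤ := fun v => G.prefixW M (ρ v) (n v)
  obtain ⟨r, α, hα⟩ := G.exists_attractor_move
  let τ : V → V := fun u => if G.ForcesDeadEnd u then α u else
    σ (List.ofFn fun i : Fin (n u) => ρ u i) u
  refine ⟨fun _ => τ, fun _ _ _ => rfl, fun _ u hP hE => ?_, fun π hπ => ?_⟩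
  · by_cases hu : G.ForcesDeadEnd u
    · simp only [τ, if_pos hu]
      exact (hα u hu).1 hP hE
    · simp only [τ, if_neg hu]
      exact hσ.1 _ u hP hE
  have hlive : ∀ k, ¬ G.ForcesDeadEnd (π k) := by
    intro k hk
    have h : ∀ m, G.ForcesDeadEnd (π (k + m)) ∧ r (π (k + m)) + m ≤ r (π k) := by
      intro m
      induction m with
      | zero => exact ⟨hk, le_rfl⟩
      | succ m ih =>
        have := (hα _ ih.1).2 _ (hπ.1.2 (k + m)) fun hP => by
          rw [hπ.2 _ hP]
          simp only [τ, if_pos ih.1]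
        exact ⟨this.1, by rw [← add_assoc k m 1]; omega⟩
    have := (h (r (π k) + 1)).2
    omega
  have hnext : ∀ k, Visited (π k) → Visited (π (k + 1)) ∧
      e (π (k + 1)) ≤ e (π k) + (G.w (π k) (π (k + 1))).unbotD (-M) := by
    intro k hk
    obtain ⟨hc, hn, -⟩ := hρn _ hk
    have hE := hπ.1.2 k
    have hext : ∃ ρ', G.Consistent σ ρ' ∧ (∀ i ≤ n (π k), ρ' i = ρ (π k) i) ∧
        ρ' (n (π k) + 1) = π (k + 1) := by
      by_cases hP : G.P1 (π k)
      · refine ⟨ρ (π k), hc, fun _ _ => rfl, ?_⟩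
        rw [hπ.2 k hP, hc.2 _ (hn.symm ▸ hP), hn]
        simp only [τ, if_neg (hlive k)]
      · exact hc.exists_deviation hσ.1 (hn.symm ▸ hP) (hn.symm ▸ hE) (hlive (k + 1))
    obtain ⟨ρ', hc', hagree, hlast⟩ := hext
    have hvis : Visited (π (k + 1)) := ⟨ρ', _, hc', hlast⟩
    refine ⟨hvis, ((hρn _ hvis).2.2 ρ' _ hc' hlast).trans ?_⟩
    rw [G.prefixW_succ, G.prefixW_congr M hagree, hagree _ le_rfl, hlast, hn]
  obtain ⟨ρ₀, hρ₀⟩ := G.exists_consistent hσ.1 (hπ.1.1 ▸ hlive 0)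
  have hρ₀π : ρ₀ 0 = π 0 := hρ₀.1.1.trans hπ.1.1.symm
  have hvis0 : Visited (π 0) := ⟨ρ₀, 0, hρ₀, hρ₀π⟩
  have hvis : ∀ k, Visited (π k) := fun k => by
    induction k with
    | zero => exact hvis0
    | succ k ih => exact (hnext k ih).1
  refine G.p1Wins_of_potential hM hnuRange hnuLB (e := e)
    ((hρn _ hvis0).2.2 ρ₀ 0 hρ₀ hρ₀π) (fun k => (hweight _ _ (hπ.1.2 k)).2)
    (fun k => (hnext k (hvis k)).2) (fun k htop => ?_) (fun k z hz => ?_)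
  · obtain ⟨hc, hn, -⟩ := hρn _ (hvis k)
    have := (hσ.2 _ hc).2 (n (π k))
    rw [hn, htop, top_le_iff] at this
    exact toE_ne_top _ this
  · obtain ⟨hc, hn, -⟩ := hρn _ (hvis k)
    exact (hσ.2 _ hc).le_prefixW M (hn.symm ▸ hz)

end SigGame

open SigGame in
/-- in a signature game whose integer threshold coefficients are all
at least `-2·W·|V|` (where `W` is the maximal absolute value of the integer edge
weights), player 1 has a winning strategy iff player 1 has a memoryless winning
strategy. -/
theorem signature_game_memoryless_determinacy
    {V : Type} [Fintype V] (G : SG V) (W : ℕ)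
    (hWbound : ∀ (u v : V) (z : ℤ), G.E u v → G.w u v = (z : WithBot ℤ) →
      z.natAbs ≤ W)
    (hWmax : W = 0 ∨ ∃ (u v : V) (z : ℤ), G.E u v ∧ G.w u v = (z : WithBot ℤ) ∧
      z.natAbs = W)
    (hnuRange : ∀ v : V, G.nu v = ⊤ ∨ G.nu v = ⊥ ∨ ∃ z : ℤ, G.nu v = ((z : ℝ) : EReal))
    (hnuLB : ∀ (v : V) (z : ℤ), G.nu v = ((z : ℝ) : EReal) →
      -(2 * (W : ℤ) * (Fintype.card V : ℤ)) ≤ z) :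
    (∃ σ : Strat V, G.WinningStrat σ) ↔
      (∃ σ : Strat V, Memoryless σ ∧ G.WinningStrat σ) := by
  constructor
  · rintro ⟨σ, hσ⟩
    exact hσ.exists_memoryless hWbound hnuRange hnuLB
  · rintro ⟨σ, -, hσ⟩
    exact ⟨σ, hσ⟩
end
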